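/- arXiv:2005.04295 — 2 statements merged into one kernel-verified Lean document; each statement's English description precedes it below -/
import Mathlib

section
/- Let n ≥ 1, let α ∈ F_{2^n}, and let β ∈ F_{2^{3n}} satisfy β³ = α. Then for all C₀, C₁, C₂, D₀, D₁, D₂ ∈ F_{2^n}: (C₀ + βC₁ + β²C₂)(D₀ + βD₁ + β²D₂) = C₀D₀ + α·( C₀D₀ + (C₀+C₁)(D₀+D₁) + (C₀+C₂)(D₀+D₂) + (C₀+C₁+C₂)(D₀+D₁+D₂) ) + β·( C₀D₀ + C₁D₁ + αC₂D₂ + (C₀+C₁)(D₀+D₁) ) + β²·( C₀D₀ + C₁D₁ + C₂D₂ + (C₀+C₂)(D₀+D₂) ). -/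
/-- Karatsuba-like multiplication formula in a degree-3 Kummer
extension. -/
theorem kummer_multiplication (n : ℕ) (hn : 1 ≤ n)
    (F K : Type) [Field F] [Field K] [Algebra (ZMod 2) F] [Algebra (ZMod 2) K]
    [Algebra F K] [IsScalarTower (ZMod 2) F K] [Fintype F] [Fintype K]
    (hF : Fintype.card F = 2 ^ n) (hK : Fintype.card K = 2 ^ (3 * n))
    (α : F) (β : K) (hβ3 : β ^ 3 = algebraMap F K α) :
    ∀ C₀ C₁ C₂ D₀ D₁ D₂ : F,
      (algebraMap F K C₀ + β * algebraMap F K C₁ + β ^ 2 * algebraMap F K C₂) *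
          (algebraMap F K D₀ + β * algebraMap F K D₁ + β ^ 2 * algebraMap F K D₂) =
        algebraMap F K (C₀ * D₀) +
          algebraMap F K (α * (C₀ * D₀ + (C₀ + C₁) * (D₀ + D₁) +
            (C₀ + C₂) * (D₀ + D₂) + (C₀ + C₁ + C₂) * (D₀ + D₁ + D₂))) +
          β * algebraMap F K (C₀ * D₀ + C₁ * D₁ + α * (C₂ * D₂) +
            (C₀ + C₁) * (D₀ + D₁)) +
          β ^ 2 * algebraMap F K (C₀ * D₀ + C₁ * D₁ + C₂ * D₂ +
            (C₀ + C₂) * (D₀ + D₂)) := by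
  intro C₀ C₁ C₂ D₀ D₁ D₂
  have : CharP K 2 := charP_of_injective_algebraMap (algebraMap (ZMod 2) K).injective 2
  have h2 : (2 : K) = 0 := CharTwo.two_eq_zero
  simp only [map_add, map_mul]
  generalize algebraMap F K α = a at *
  generalize algebraMap F K C₀ = c₀
  generalize algebraMap F K C₁ = c₁
  generalize algebraMap F K C₂ = c₂
  generalize algebraMap F K D₀ = d₀
  generalize algebraMap F K D₁ = d₁
  generalize algebraMap F K D₂ = d₂
  linear_combination (c₁ * d₂ + c₂ * d₁ + β * (c₂ * d₂)) * hβ3 -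
    (a * (2 * c₀ * d₀ + c₀ * d₁ + c₁ * d₀ + c₀ * d₂ + c₂ * d₀ + c₁ * d₁ + c₂ * d₂) +
      β * (c₀ * d₀ + c₁ * d₁) + β ^ 2 * (c₀ * d₀ + c₂ * d₂)) * h2
end

section
/- Let n ≥ 1 with 3 dividing 2^n − 1, let α ∈ F_{2^n} be a generator of the multiplicative group F_{2^n}^×, and let β ∈ F_{2^{3n}} satisfy β³ = α. Assume that the 3-adic valuation satisfies v₃((2^{3n} − 1)/(2^n − 1)) = 1. Then β has multiplicative order 3(2^n − 1) in F_{2^{3n}}^×, β is not a cube in F_{2^{3n}}, and the polynomial X³ − β is irreducible over F_{2^{3n}}. -/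
open Polynomial

theorem orderOf_eq_prime_mul_orderOf_pow {M : Type*} [Monoid M] {p : ℕ} (hp : p.Prime) {x : M}
    (h : p ∣ orderOf (x ^ p)) : orderOf x = p * orderOf (x ^ p) := by
  have hpx : p ∣ orderOf x := h.trans (orderOf_pow_dvd p)
  rw [orderOf_pow' x hp.ne_zero, Nat.gcd_eq_right hpx, Nat.mul_div_cancel' hpx]

/-- If `α` generates `F_{2^n}^×`, `β³ = α` in `F_{2^{3n}}`, and
`v₃((2^{3n}-1)/(2^n-1)) = 1`, then `β` has order `3(2^n-1)`, `β` is not a cube in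
`F_{2^{3n}}`, and `X³ - β` is irreducible over `F_{2^{3n}}`. -/
theorem bicubic_kummer_extension (n : ℕ) (hn : 1 ≤ n) (h3 : 3 ∣ 2 ^ n - 1)
    (F K : Type) [Field F] [Field K] [Algebra (ZMod 2) F] [Algebra (ZMod 2) K]
    [Algebra F K] [IsScalarTower (ZMod 2) F K] [Fintype F] [Fintype K]
    (hF : Fintype.card F = 2 ^ n) (hK : Fintype.card K = 2 ^ (3 * n))
    (α : F) (hprim : orderOf α = 2 ^ n - 1)
    (β : K) (hβ3 : β ^ 3 = algebraMap F K α)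
    (hval : padicValNat 3 ((2 ^ (3 * n) - 1) / (2 ^ n - 1)) = 1) :
    orderOf β = 3 * (2 ^ n - 1) ∧ (¬∃ γ : K, γ ^ 3 = β) ∧
      Irreducible (X ^ 3 - C β) := by
  have hβpow : orderOf (β ^ 3) = 2 ^ n - 1 := by
    rw [hβ3, ← hprim]
    exact orderOf_injective (algebraMap F K : F →* K) (algebraMap F K).injective α
  have hβ : orderOf β = 3 * (2 ^ n - 1) := by
    rw [orderOf_eq_prime_mul_orderOf_pow Nat.prime_three (hβpow ▸ h3), hβpow]
  have hcube : ¬∃ γ : K, γ ^ 3 = β := by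
    rintro ⟨γ, rfl⟩
    have hγ : orderOf γ = 3 * (3 * (2 ^ n - 1)) := by
      rw [orderOf_eq_prime_mul_orderOf_pow Nat.prime_three (hβ ▸ dvd_mul_right 3 _), hβ]
    have hpos : 0 < 2 ^ n - 1 := Nat.sub_pos_of_lt (Nat.one_lt_two_pow (by omega))
    have hγ0 : γ ≠ 0 := by
      rintro rfl
      rw [orderOf_zero] at hγ
      omega
    have hγK : 3 ^ 2 * (2 ^ n - 1) ∣ 2 ^ (3 * n) - 1 := by
      rw [sq, mul_assoc, ← hγ, ← hK]
      exact orderOf_dvd_of_pow_eq_one (FiniteField.pow_card_sub_one_eq_one γ hγ0)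
    have hquot : (2 ^ (3 * n) - 1) / (2 ^ n - 1) ≠ 0 := by
      intro h
      simp [h] at hval
    have h9 : 3 ^ 2 ∣ (2 ^ (3 * n) - 1) / (2 ^ n - 1) :=
      Nat.dvd_div_of_mul_dvd (by rwa [mul_comm])
    have := (padicValNat_dvd_iff_le hquot).mp h9
    omega
  exact ⟨hβ, hcube,
    X_pow_sub_C_irreducible_of_prime Nat.prime_three fun γ hγ => hcube ⟨γ, hγ⟩⟩
end
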